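/- The staggered double ring D_{Nd}(R,R′) is a relative equilibrium with explicit angular velocity (Theorem 3.7 and Proposition 3.8, case without poles): Let N ≥ 2 and θ ∈ (0, π/2]. Consider the configuration of n = 2N vortices with positions p j = (sin θ · cos (2πj/N), sin θ · sin (2πj/N), cos θ) of vorticity +1 and q j = (sin θ · cos ((2j+1)π/N), sin θ · sin ((2j+1)π/N), −cos θ) of vorticity −1, for j = 0, …, N−1. Set ξ = cos θ · [ (N−1)/sin²θ + Σ_{j=0}^{N−1} (1 + cos ((2j+1)π/N)) / (2 − sin²θ · (1 + cos ((2j+1)π/N))) ]. Then F(x) i = ξ • ((0,0,1) × x i) for every vortex x i of the configuration; in particular the configuration is a relative equilibrium rotating about the z-axis with angular velocity ξ, and for θ = π/2 it is a fixed equilibrium. -/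

import Mathlib

open scoped RealInnerProductSpace BigOperators

noncomputable section

/-- Euclidean 3-space. -/
abbrev R3 : Type := EuclideanSpace ℝ (Fin 3)

/-- The vector of `R3` with the given coordinates. -/
def v3 (a b c : ℝ) : R3 := (WithLp.equiv 2 (Fin 3 → ℝ)).symm ![a, b, c]

/-- Cross product on `R3`. -/
def cross (u v : R3) : R3 :=
  v3 (u 1 * v 2 - u 2 * v 1) (u 2 * v 0 - u 0 * v 2) (u 0 * v 1 - u 1 * v 0)

/-- The point-vortex vector field on the sphere:
`F(x) i = Σ_{j ≠ i} (λ j / (1 − ⟪x i, x j⟫)) • (x j × x i)`. -/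
def vortexF {ι : Type} [Fintype ι] [DecidableEq ι] (lam : ι → ℝ) (x : ι → R3) (i : ι) : R3 :=
  ∑ j ∈ Finset.univ.filter (fun j => j ≠ i), (lam j / (1 - ⟪x i, x j⟫)) • cross (x j) (x i)

/-- The point-vortex Hamiltonian `H(y) = Σ_{i<j} λ i λ j log ‖y i − y j‖²`. -/
def vortexH (n : ℕ) (lam : Fin n → ℝ) (y : Fin n → R3) : ℝ :=
  ∑ p ∈ Finset.univ.filter (fun p : Fin n × Fin n => p.1 < p.2),
    lam p.1 * lam p.2 * Real.log (‖y p.1 - y p.2‖ ^ 2)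

/-- The centre of vorticity `Φ(y) = Σ_i λ i • y i`. -/
def vorticityCentre (n : ℕ) (lam : Fin n → ℝ) (y : Fin n → R3) : R3 := ∑ i, lam i • y i

theorem sum_fin_add_int_of_periodic {N : ℕ} {f : ℤ → ℝ} (hf : ∀ k, f (k + N) = f k) (a : ℤ) :
    ∑ j : Fin N, f ((j : ℕ) + a) = ∑ j : Fin N, f ((j : ℕ) : ℤ) := by
  have step (b : ℤ) : ∑ j : Fin N, f ((j : ℕ) + (b + 1)) = ∑ j : Fin N, f ((j : ℕ) + b) := by
    rw [Fin.sum_univ_eq_sum_range (fun j : ℕ => f (j + (b + 1))),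
      Fin.sum_univ_eq_sum_range (fun j : ℕ => f (j + b))]
    have h1 := Finset.sum_range_succ (fun j : ℕ => f (j + b)) N
    have h2 := Finset.sum_range_succ' (fun j : ℕ => f (j + b)) N
    have h3 : f ((N : ℤ) + b) = f (((0 : ℕ) : ℤ) + b) := by
      rw [add_comm, hf]; simp
    have h4 : ∑ j ∈ Finset.range N, f (((j + 1 : ℕ) : ℤ) + b) =
        ∑ j ∈ Finset.range N, f ((j : ℤ) + (b + 1)) := by
      refine Finset.sum_congr rfl fun j _ => ?_
      congr 1
      push_cast
      ring
    linarith
  induction a using Int.induction_on with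
  | zero => simp
  | succ k ih => rw [step, ih]
  | pred k ih => rw [← step, sub_add_cancel, ih]

theorem sum_fin_eq_zero_of_periodic_of_reflect {N : ℕ} {f : ℤ → ℝ} (hf : ∀ k, f (k + N) = f k)
    (b : ℤ) (hodd : ∀ k, f (b - k) = -f k) : ∑ j : Fin N, f ((j : ℕ) : ℤ) = 0 := by
  have h1 : ∑ j : Fin N, f ((j : ℕ) : ℤ) = ∑ j : Fin N, -f ((j : ℕ) + (b + 1 - N)) := by
    rw [← Equiv.sum_comp Fin.revPerm]
    refine Finset.sum_congr rfl fun j _ => ?_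
    rw [← hodd]
    congr 1
    have := j.isLt
    simp only [Fin.revPerm_apply, Fin.val_rev]
    omega
  rw [Finset.sum_neg_distrib, sum_fin_add_int_of_periodic hf] at h1
  linarith

@[simp] theorem v3_apply_zero (a b c : ℝ) : v3 a b c 0 = a := rfl

@[simp] theorem v3_apply_one (a b c : ℝ) : v3 a b c 1 = b := rfl

@[simp] theorem v3_apply_two (a b c : ℝ) : v3 a b c 2 = c := rfl

theorem inner_v3 (a b c a' b' c' : ℝ) :
    ⟪v3 a b c, v3 a' b' c'⟫ = a * a' + b * b' + c * c' := by
  simp [PiLp.inner_apply, Fin.sum_univ_three, mul_comm]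

theorem R3_ext {u v : R3} (h0 : u 0 = v 0) (h1 : u 1 = v 1) (h2 : u 2 = v 2) : u = v := by
  ext i
  fin_cases i
  exacts [h0, h1, h2]

theorem cross_same (u : R3) : cross u u = 0 := by
  apply R3_ext <;> simp [cross] <;> ring

theorem vortexF_eq_sum {ι : Type} [Fintype ι] [DecidableEq ι] (lam : ι → ℝ) (x : ι → R3) (i : ι) :
    vortexF lam x i = ∑ j, (lam j / (1 - ⟪x i, x j⟫)) • cross (x j) (x i) := by
  refine Finset.sum_subset (Finset.filter_subset _ _) fun j _ hj => ?_
  obtain rfl : j = i := by simpa using hj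
  rw [cross_same, smul_zero]

/-- The point of the circle of radius `s` at height `h` with azimuth `α`. -/
def ringPoint (s h α : ℝ) : R3 := v3 (s * Real.cos α) (s * Real.sin α) h

/-- A ring of vortices at height `ε * h` whose azimuths are symmetrically distributed around that
of a vortex at height `h` makes the latter rotate about the `z`-axis. -/
theorem sum_ringPoint_smul_cross {ι : Type} [Fintype ι] (s h l ε α : ℝ) (φ : ι → ℝ)
    (hodd : ∑ j, Real.sin (φ j) / (1 - s ^ 2 * Real.cos (φ j) - ε * h ^ 2) = 0) :
    ∑ j, (l / (1 - ⟪ringPoint s h α, ringPoint s (ε * h) (α + φ j)⟫)) •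
        cross (ringPoint s (ε * h) (α + φ j)) (ringPoint s h α) =
      (-(l * h * ∑ j, (Real.cos (φ j) - ε) / (1 - s ^ 2 * Real.cos (φ j) - ε * h ^ 2))) •
        cross (v3 0 0 1) (ringPoint s h α) := by
  have hD (j : ι) : 1 - ⟪ringPoint s h α, ringPoint s (ε * h) (α + φ j)⟫ =
      1 - s ^ 2 * Real.cos (φ j) - ε * h ^ 2 := by
    rw [ringPoint, ringPoint, inner_v3, Real.cos_add, Real.sin_add]
    linear_combination (-s ^ 2 * Real.cos (φ j)) * Real.sin_sq_add_cos_sq α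
  simp only [hD]
  set D : ι → ℝ := fun j => 1 - s ^ 2 * Real.cos (φ j) - ε * h ^ 2
  have key (A B : ℝ) : ∑ j, (l / D j) * (A * (Real.cos (φ j) - ε) + B * Real.sin (φ j)) =
      l * A * ∑ j, (Real.cos (φ j) - ε) / D j := by
    calc _ = ∑ j, (l * A * ((Real.cos (φ j) - ε) / D j) + l * B * (Real.sin (φ j) / D j)) :=
          Finset.sum_congr rfl fun j _ => by ring
      _ = _ := by rw [Finset.sum_add_distrib, ← Finset.mul_sum, ← Finset.mul_sum, hodd]; ring
  apply R3_ext
  · have := key (s * h * Real.sin α) (s * h * Real.cos α)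
    simp only [WithLp.ofLp_sum, Finset.sum_apply, PiLp.smul_apply, smul_eq_mul, cross, ringPoint,
      v3_apply_zero, v3_apply_one, v3_apply_two]
    trans l * (s * h * Real.sin α) * ∑ j, (Real.cos (φ j) - ε) / D j
    · rw [← this]
      refine Finset.sum_congr rfl fun j _ => ?_
      rw [Real.sin_add]
      ring
    · ring
  · have := key (-(s * h * Real.cos α)) (s * h * Real.sin α)
    simp only [WithLp.ofLp_sum, Finset.sum_apply, PiLp.smul_apply, smul_eq_mul, cross, ringPoint,
      v3_apply_zero, v3_apply_one, v3_apply_two]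
    trans l * (-(s * h * Real.cos α)) * ∑ j, (Real.cos (φ j) - ε) / D j
    · rw [← this]
      refine Finset.sum_congr rfl fun j _ => ?_
      rw [Real.cos_add]
      ring
    · ring
  · have := key 0 (-s ^ 2)
    simp only [WithLp.ofLp_sum, Finset.sum_apply, PiLp.smul_apply, smul_eq_mul, cross, ringPoint,
      v3_apply_zero, v3_apply_one, v3_apply_two]
    trans l * 0 * ∑ j, (Real.cos (φ j) - ε) / D j
    · rw [← this]
      refine Finset.sum_congr rfl fun j _ => ?_
      rw [Real.cos_add, Real.sin_add]
      linear_combination (-l / D j * s ^ 2 * Real.sin (φ j)) * Real.sin_sq_add_cos_sq α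
    · ring

/-- The angle `(2 k + d) π / N`: a vertex of the regular `N`-gon for `d = 0`, and of its staggered
copy for `d = 1`. -/
def ringAngle (N : ℕ) (d k : ℤ) : ℝ := (2 * k + d) * Real.pi / N

section RingAngle

variable {N : ℕ}

theorem ringAngle_add_period (hN : N ≠ 0) (d k : ℤ) :
    ringAngle N d (k + N) = ringAngle N d k + 2 * Real.pi := by
  have : (N : ℝ) ≠ 0 := by exact_mod_cast hN
  simp only [ringAngle]
  push_cast
  field_simp
  ring

theorem ringAngle_reflect (d k : ℤ) : ringAngle N d (-d - k) = -ringAngle N d k := by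
  simp only [ringAngle]
  push_cast
  ring

theorem sum_ringAngle_shift (hN : N ≠ 0) (F : ℝ → ℝ) (hF : F.Periodic (2 * Real.pi)) (d a : ℤ) :
    ∑ j : Fin N, F (ringAngle N d ((j : ℕ) + a)) =
      ∑ j : Fin N, F (ringAngle N d ((j : ℕ) : ℤ)) :=
  sum_fin_add_int_of_periodic (f := fun k => F (ringAngle N d k))
    (fun k => by rw [ringAngle_add_period hN, hF]) a

theorem sum_ringAngle_odd (hN : N ≠ 0) (F : ℝ → ℝ) (hF : F.Periodic (2 * Real.pi))
    (hodd : F.Odd) (d a : ℤ) : ∑ j : Fin N, F (ringAngle N d ((j : ℕ) + a)) = 0 := by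
  rw [sum_ringAngle_shift hN F hF]
  exact sum_fin_eq_zero_of_periodic_of_reflect (f := fun k => F (ringAngle N d k))
    (fun k => by rw [ringAngle_add_period hN, hF]) (-d) fun k => by
      rw [ringAngle_reflect, hodd]

theorem sum_ringPoint_ringAngle_smul_cross (hN : N ≠ 0) (s l : ℝ) {h h' ε : ℝ} (hh : h' = ε * h)
    {d d' e a : ℤ} (hd : d' = d + e + 2 * a) (i : ℤ) :
    ∑ j : Fin N, (l / (1 - ⟪ringPoint s h (ringAngle N d i),
        ringPoint s h' (ringAngle N d' ((j : ℕ) : ℤ))⟫)) •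
        cross (ringPoint s h' (ringAngle N d' ((j : ℕ) : ℤ))) (ringPoint s h (ringAngle N d i)) =
      (-(l * h * ∑ j : Fin N, (Real.cos (ringAngle N e ((j : ℕ) : ℤ)) - ε) /
        (1 - s ^ 2 * Real.cos (ringAngle N e ((j : ℕ) : ℤ)) - ε * h ^ 2))) •
        cross (v3 0 0 1) (ringPoint s h (ringAngle N d i)) := by
  have hangle (j : Fin N) : ringAngle N d' ((j : ℕ) : ℤ) =
      ringAngle N d i + ringAngle N e ((j : ℕ) + (a - i)) := by
    rw [hd]
    simp only [ringAngle]
    push_cast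
    ring
  simp only [hangle, hh]
  rw [sum_ringPoint_smul_cross]
  · rw [sum_ringAngle_shift hN
      (fun t => (Real.cos t - ε) / (1 - s ^ 2 * Real.cos t - ε * h ^ 2)) fun t => by
        simp only [Real.cos_add_two_pi]]
  · exact sum_ringAngle_odd hN (fun t => Real.sin t / (1 - s ^ 2 * Real.cos t - ε * h ^ 2))
      (fun t => by simp only [Real.cos_add_two_pi, Real.sin_add_two_pi])
      (fun t => by simp only [Real.cos_neg, Real.sin_neg, neg_div]) e (a - i)

theorem cos_ringAngle_ne_one (j : Fin N) (hj : (j : ℕ) ≠ 0) :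
    Real.cos (ringAngle N 0 ((j : ℕ) : ℤ)) ≠ 1 := by
  have hlt : ((j : ℕ) : ℝ) < N := by exact_mod_cast j.isLt
  have hpos : (0 : ℝ) < (j : ℕ) := by exact_mod_cast Nat.pos_of_ne_zero hj
  have hN : (0 : ℝ) < N := hpos.trans hlt
  have hang : ringAngle N 0 ((j : ℕ) : ℤ) = (j : ℕ) / N * (2 * Real.pi) := by
    simp only [ringAngle]
    push_cast
    ring
  have hq : ((j : ℕ) : ℝ) / N < 1 := (div_lt_one hN).2 hlt
  have hq0 : 0 < ((j : ℕ) : ℝ) / N := by positivity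
  intro h
  rw [hang, Real.cos_eq_one_iff_of_lt_of_lt (by nlinarith [Real.pi_pos])
    (by nlinarith [Real.pi_pos])] at h
  have := mul_pos hq0 Real.two_pi_pos
  linarith

theorem sum_same_ring (hN : N ≠ 0) {s h : ℝ} (hs : s ≠ 0) (hsh : s ^ 2 + h ^ 2 = 1) :
    ∑ j : Fin N, (Real.cos (ringAngle N 0 ((j : ℕ) : ℤ)) - 1) /
        (1 - s ^ 2 * Real.cos (ringAngle N 0 ((j : ℕ) : ℤ)) - 1 * h ^ 2) =
      -((N - 1) / s ^ 2) := by
  obtain ⟨M, rfl⟩ := Nat.exists_eq_succ_of_ne_zero hN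
  rw [Fin.sum_univ_succ]
  have hterm (j : Fin M) : (Real.cos (ringAngle (M + 1) 0 ((j.succ : ℕ) : ℤ)) - 1) /
      (1 - s ^ 2 * Real.cos (ringAngle (M + 1) 0 ((j.succ : ℕ) : ℤ)) - 1 * h ^ 2) =
      -(1 / s ^ 2) := by
    have hc := sub_ne_zero.2 (cos_ringAngle_ne_one j.succ (by simp))
    rw [show 1 - s ^ 2 * Real.cos (ringAngle (M + 1) 0 ((j.succ : ℕ) : ℤ)) - 1 * h ^ 2 =
      -(s ^ 2 * (Real.cos (ringAngle (M + 1) 0 ((j.succ : ℕ) : ℤ)) - 1)) by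
        linear_combination -hsh]
    field_simp
  rw [Finset.sum_congr rfl fun j _ => hterm j]
  simp [ringAngle]
  ring

end RingAngle

/-- the staggered double ring `D_{Nd}(R,R′)` is a relative equilibrium
rotating about the `z`-axis with the explicit angular velocity of Proposition 3.8
(no poles); for `θ = π/2` it is a fixed equilibrium. -/
theorem DNd_double_ring_relative_equilibrium (N : ℕ) (hN : 2 ≤ N)
    (θ : ℝ) (hθ : θ ∈ Set.Ioc 0 (Real.pi / 2))
    (lam : Fin N ⊕ Fin N → ℝ) (x : Fin N ⊕ Fin N → R3) (ξ : ℝ)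
    (hlamp : ∀ j : Fin N, lam (Sum.inl j) = 1)
    (hlamm : ∀ j : Fin N, lam (Sum.inr j) = -1)
    (hxp : ∀ j : Fin N, x (Sum.inl j) =
      v3 (Real.sin θ * Real.cos (2 * Real.pi * ((j : ℕ) : ℝ) / (N : ℝ)))
         (Real.sin θ * Real.sin (2 * Real.pi * ((j : ℕ) : ℝ) / (N : ℝ)))
         (Real.cos θ))
    (hxm : ∀ j : Fin N, x (Sum.inr j) =
      v3 (Real.sin θ * Real.cos ((2 * ((j : ℕ) : ℝ) + 1) * Real.pi / (N : ℝ)))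
         (Real.sin θ * Real.sin ((2 * ((j : ℕ) : ℝ) + 1) * Real.pi / (N : ℝ)))
         (-Real.cos θ))
    (hξ : ξ = Real.cos θ * (((N : ℝ) - 1) / Real.sin θ ^ 2 +
      ∑ j : Fin N, (1 + Real.cos ((2 * ((j : ℕ) : ℝ) + 1) * Real.pi / (N : ℝ))) /
        (2 - Real.sin θ ^ 2 *
          (1 + Real.cos ((2 * ((j : ℕ) : ℝ) + 1) * Real.pi / (N : ℝ)))))) :
    (∀ i, vortexF lam x i = ξ • cross (v3 0 0 1) (x i)) ∧
    (θ = Real.pi / 2 → ∀ i, vortexF lam x i = 0) := by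
  have hN0 : N ≠ 0 := by omega
  have hs : Real.sin θ ≠ 0 :=
    (Real.sin_pos_of_pos_of_lt_pi hθ.1 (by linarith [hθ.2, Real.pi_pos])).ne'
  have hsc : Real.sin θ ^ 2 + Real.cos θ ^ 2 = 1 := Real.sin_sq_add_cos_sq θ
  have hp (j : Fin N) : x (Sum.inl j) =
      ringPoint (Real.sin θ) (Real.cos θ) (ringAngle N 0 ((j : ℕ) : ℤ)) := by
    rw [hxp, ringPoint, ringAngle]
    congr 3 <;> push_cast <;> ring_nf
  have hm (j : Fin N) : x (Sum.inr j) =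
      ringPoint (Real.sin θ) (-Real.cos θ) (ringAngle N 1 ((j : ℕ) : ℤ)) := by
    rw [hxm, ringPoint, ringAngle]
    push_cast
    rfl
  have hopp : ∑ j : Fin N, (Real.cos (ringAngle N 1 ((j : ℕ) : ℤ)) - (-1)) /
        (1 - Real.sin θ ^ 2 * Real.cos (ringAngle N 1 ((j : ℕ) : ℤ)) - (-1) * Real.cos θ ^ 2) =
      ∑ j : Fin N, (1 + Real.cos ((2 * ((j : ℕ) : ℝ) + 1) * Real.pi / (N : ℝ))) /
        (2 - Real.sin θ ^ 2 *
          (1 + Real.cos ((2 * ((j : ℕ) : ℝ) + 1) * Real.pi / (N : ℝ)))) := by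
    refine Finset.sum_congr rfl fun j _ => ?_
    simp only [ringAngle]
    push_cast
    congr 1
    · ring
    · linear_combination hsc
  have main : ∀ i, vortexF lam x i = ξ • cross (v3 0 0 1) (x i) := by
    rintro (i | i) <;> rw [vortexF_eq_sum, Fintype.sum_sum_type] <;>
      simp only [hlamp, hlamm, hp, hm]
    · rw [sum_ringPoint_ringAngle_smul_cross hN0 _ _ (one_mul _).symm
          (show (0 : ℤ) = 0 + 0 + 2 * 0 by norm_num),
        sum_ringPoint_ringAngle_smul_cross hN0 _ _ (neg_one_mul _).symm
          (show (1 : ℤ) = 0 + 1 + 2 * 0 by norm_num),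
        ← add_smul, sum_same_ring hN0 hs hsc, hopp, hξ]
      congr 1
      ring
    · rw [sum_ringPoint_ringAngle_smul_cross hN0 _ _ (show Real.cos θ = -1 * -Real.cos θ by ring)
          (show (0 : ℤ) = 1 + 1 + 2 * (-1) by norm_num),
        sum_ringPoint_ringAngle_smul_cross hN0 _ _ (one_mul _).symm
          (show (1 : ℤ) = 1 + 0 + 2 * 0 by norm_num),
        ← add_smul, neg_sq, sum_same_ring hN0 hs hsc, hopp, hξ]
      congr 1
      ring
  refine ⟨main, fun h i => ?_⟩
  rw [main, hξ, h, Real.cos_pi_div_two, zero_mul, zero_smul]
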